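/- arXiv:2307.00896 — 5 statements merged into one kernel-verified Lean document; each statement's English description precedes it below -/
import Mathlib

section
/- Let α ∈ (0,2) and a ∈ (0,1). Define the Poisson kernel P_{(0,a)}(x,y) = C_α ((a-x)x / (y(y-a)))^{α/2} |x-y|^{-1} for x ∈ (0,a) and y ∈ ℝ∖[0,a] (note y(y-a) > 0 there). Then lim_{t→0⁺} t^{-α/2} ( ∫_{-∞}^0 P_{(0,a)}(a-t, y) dy + ∫_1^∞ P_{(0,a)}(a-t, y) dy ) = C_α ( T_α a^{-α/2} + α^{-1} a^{α/2} F_α(a) ). -/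
open MeasureTheory Real Filter Set

/-- Euler Beta function `B(x,y) = ∫₀¹ t^(x-1) (1-t)^(y-1) dt`. -/
noncomputable def betaFn (x y : ℝ) : ℝ :=
  ∫ t in (0:ℝ)..1, t ^ (x - 1) * (1 - t) ^ (y - 1)

/-- `C_α = π⁻¹ sin(π α / 2)`. -/
noncomputable def Cc (α : ℝ) : ℝ := Real.sin (Real.pi * α / 2) / Real.pi

/-- `T_α = B(α, 1 - α/2)`. -/
noncomputable def Tc (α : ℝ) : ℝ := betaFn α (1 - α / 2)

/-- Gauss hypergeometric series `₂F₁(p, q; r; z)`. -/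
noncomputable def hyp (p q r z : ℝ) : ℝ :=
  ∑' n : ℕ, ((ascPochhammer ℝ n).eval p * (ascPochhammer ℝ n).eval q) /
    ((ascPochhammer ℝ n).eval r * (n.factorial : ℝ)) * z ^ n

/-- Poisson kernel of the fractional Laplacian for the interval `(0,a)`:
`P_{(0,a)}(x,y) = C_α ((a-x)x/(y(y-a)))^(α/2) |x-y|⁻¹`. -/
noncomputable def P0 (α a x y : ℝ) : ℝ :=
  Cc α * (((a - x) * x) / (y * (y - a))) ^ (α / 2) * |x - y|⁻¹

open Topology

theorem hasSum_ascPochhammer_mul_pow (c : ℝ) {x : ℝ} (hx : |x| < 1) :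
    HasSum (fun n : ℕ => (ascPochhammer ℝ n).eval c / (n.factorial : ℝ) * x ^ n)
      ((1 - x) ^ (-c)) := by
  have h := (Real.one_div_one_sub_rpow_hasFPowerSeriesOnBall_zero c).hasSum (y := x)
    (by simpa [enorm_eq_nnnorm, ← NNReal.coe_lt_one] using hx)
  have hx' : 0 < 1 - x := by linarith [(abs_lt.1 hx).2]
  rw [zero_add, one_div, ← rpow_neg hx'.le] at h
  refine h.congr_fun fun n => ?_
  have hn : (n.factorial : ℝ) ≠ 0 := by exact_mod_cast n.factorial_ne_zero
  have hm := Ring.factorial_nsmul_multichoose_eq_ascPochhammer c n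
  rw [Polynomial.ascPochhammer_smeval_eq_eval, Ring.multichoose_eq, nsmul_eq_mul] at hm
  rw [FormalMultilinearSeries.ofScalars_apply_eq, ← hm]
  field_simp
  simp

theorem ascPochhammer_eval_mul_add (q : ℝ) (n : ℕ) :
    (ascPochhammer ℝ n).eval q * (q + n) = q * (ascPochhammer ℝ n).eval (q + 1) := by
  rw [← ascPochhammer_succ_eval, ascPochhammer_succ_left]
  simp

theorem integrableOn_rpow_mul_one_sub_rpow {x y : ℝ} (hx : 0 < x) (hy : 0 < y) :
    IntegrableOn (fun s : ℝ => s ^ (x - 1) * (1 - s) ^ (y - 1)) (Ioo 0 1) := by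
  have h := Complex.betaIntegral_convergent (u := x) (v := y) (by simpa) (by simpa)
  rw [intervalIntegrable_iff_integrableOn_Ioo_of_le zero_le_one] at h
  refine IntegrableOn.congr_fun h.norm (fun s hs => ?_) measurableSet_Ioo
  have h1 : (0 : ℝ) < 1 - s := by linarith [hs.2]
  have e : ((1 : ℂ) - s) = ((1 - s : ℝ) : ℂ) := by push_cast; rfl
  simp only [norm_mul]
  rw [e, Complex.norm_cpow_eq_rpow_re_of_pos hs.1, Complex.norm_cpow_eq_rpow_re_of_pos h1]
  simp

theorem integral_rpow_mul_one_sub_rpow {x y : ℝ} :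
    ∫ s in Ioo (0 : ℝ) 1, s ^ (x - 1) * (1 - s) ^ (y - 1) = betaFn x y := by
  rw [betaFn, intervalIntegral.integral_of_le zero_le_one, integral_Ioc_eq_integral_Ioo]

theorem integrableOn_rpow_sub_one {q : ℝ} (hq : 0 < q) :
    IntegrableOn (fun s : ℝ => s ^ (q - 1)) (Ioo 0 1) := by
  simpa using integrableOn_rpow_mul_one_sub_rpow hq one_pos

theorem integral_rpow_sub_one {q : ℝ} (hq : 0 < q) :
    ∫ s in Ioo (0 : ℝ) 1, s ^ (q - 1) = q⁻¹ := by
  rw [← integral_Ioc_eq_integral_Ioo, ← intervalIntegral.integral_of_le zero_le_one,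
    integral_rpow (Or.inl (by linarith))]
  simp [hq.ne']

/-- Euler's integral representation of `₂F₁(p, q; q + 1; a)`. -/
theorem integral_rpow_mul_one_sub_mul_rpow {p q a : ℝ} (hp : 0 < p) (hq : 0 < q)
    (ha : a ∈ Ioo (0 : ℝ) 1) :
    ∫ s in Ioo (0 : ℝ) 1, s ^ (q - 1) * (1 - a * s) ^ (-p) = q⁻¹ * hyp p q (q + 1) a := by
  set F : ℕ → ℝ → ℝ := fun n s =>
    (ascPochhammer ℝ n).eval p / (n.factorial : ℝ) * a ^ n * s ^ (q + n - 1) with hF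
  have hqn (n : ℕ) : 0 < q + n := by positivity
  have hc (n : ℕ) : 0 ≤ (ascPochhammer ℝ n).eval p / (n.factorial : ℝ) * a ^ n := by
    have := (ascPochhammer_pos n p hp).le
    have := ha.1
    positivity
  have hint (n : ℕ) : ∫ s in Ioo (0 : ℝ) 1, F n s =
      (ascPochhammer ℝ n).eval p / (n.factorial : ℝ) * a ^ n * (q + n)⁻¹ := by
    rw [hF]
    simp only
    rw [integral_const_mul, integral_rpow_sub_one (hqn n)]
  have hsum : Summable fun n => ∫ s in Ioo (0 : ℝ) 1, ‖F n s‖ := by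
    have hn (n : ℕ) : ∫ s in Ioo (0 : ℝ) 1, ‖F n s‖ =
        (ascPochhammer ℝ n).eval p / (n.factorial : ℝ) * a ^ n * (q + n)⁻¹ := by
      rw [← hint]
      refine setIntegral_congr_fun measurableSet_Ioo fun s hs => ?_
      exact norm_of_nonneg (mul_nonneg (hc n) (rpow_nonneg hs.1.le _))
    simp_rw [hn]
    refine Summable.of_nonneg_of_le (fun n => mul_nonneg (hc n) (inv_nonneg.2 (hqn n).le))
      (fun n => ?_) ((hasSum_ascPochhammer_mul_pow p
        (by rw [abs_of_pos ha.1]; exact ha.2)).summable.mul_right q⁻¹)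
    have : (q + n)⁻¹ ≤ q⁻¹ := inv_anti₀ hq (by simp)
    exact mul_le_mul_of_nonneg_left this (hc n)
  have h := hasSum_integral_of_summable_integral_norm
    (fun n => (integrableOn_rpow_sub_one (hqn n)).const_mul _) hsum
  have hL : ∫ s in Ioo (0 : ℝ) 1, s ^ (q - 1) * (1 - a * s) ^ (-p) =
      ∫ s in Ioo (0 : ℝ) 1, ∑' n, F n s := by
    refine setIntegral_congr_fun measurableSet_Ioo fun s hs => ?_
    have has : |a * s| < 1 := by
      rw [abs_of_pos (mul_pos ha.1 hs.1)]
      nlinarith [ha.1, ha.2, hs.1, hs.2]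
    refine (((hasSum_ascPochhammer_mul_pow p has).mul_left (s ^ (q - 1))).congr_fun
      fun n => ?_).tsum_eq.symm
    have : q + n - 1 = (q - 1) + n := by ring
    simp only [hF, this, rpow_add hs.1, rpow_natCast, mul_pow]
    ring
  rw [hL, ← h.tsum_eq, hyp, ← tsum_mul_left]
  congr 1
  ext n
  rw [hint]
  have h1 := ascPochhammer_eval_mul_add q n
  have h2 := (ascPochhammer_pos n (q + 1) (by linarith)).ne'
  have h3 := (hqn n).ne'
  have hn : (n.factorial : ℝ) ≠ 0 := by exact_mod_cast n.factorial_ne_zero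
  field_simp
  linear_combination -(1 : ℝ) * (ascPochhammer ℝ n).eval p * a ^ n * h1

/-- The limiting kernel `(y (y - a))^(-b) |a - y|⁻¹` on the negative half-line, after the
substitution `y = a - a / s`. -/
theorem limit_kernel_Iio {a b : ℝ} (ha : 0 < a) (hb : b ∈ Ioo (0 : ℝ) 1) :
    IntegrableOn (fun y : ℝ => (y * (y - a)) ^ (-b) * |a - y|⁻¹) (Iio 0) ∧
    ∫ y in Iio (0 : ℝ), (y * (y - a)) ^ (-b) * |a - y|⁻¹ =
      a ^ (-(2 * b)) * betaFn (2 * b) (1 - b) := by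
  have himg : (fun s : ℝ => a - a / s) '' Ioo 0 1 = Iio 0 := by
    ext y
    simp only [mem_image, mem_Ioo, mem_Iio]
    constructor
    · rintro ⟨s, ⟨h0, h1⟩, rfl⟩
      rw [sub_neg, lt_div_iff₀ h0]
      nlinarith
    · intro hy
      have : 0 < a - y := by linarith
      refine ⟨a / (a - y), ⟨by positivity, by rw [div_lt_one this]; linarith⟩, ?_⟩
      field_simp
      ring
  have hd : ∀ s ∈ Ioo (0 : ℝ) 1,
      HasDerivWithinAt (fun s : ℝ => a - a / s) (a / s ^ 2) (Ioo 0 1) s := fun s hs => by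
    have := ((hasDerivAt_inv hs.1.ne').const_mul a).const_sub a
    simpa [div_eq_mul_inv] using this.hasDerivWithinAt
  have hinj : InjOn (fun s : ℝ => a - a / s) (Ioo 0 1) := fun s hs s' hs' h => by
    have h1 := hs.1.ne'
    have h2 := hs'.1.ne'
    simp only [sub_right_inj] at h
    field_simp at h
    exact h.symm
  have heq : ∀ s ∈ Ioo (0 : ℝ) 1, a ^ (-(2 * b)) * (s ^ (2 * b - 1) * (1 - s) ^ (1 - b - 1)) =
      |a / s ^ 2| • (((a - a / s) * (a - a / s - a)) ^ (-b) * |a - (a - a / s)|⁻¹) :=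
    fun s hs => by
    have h0 := hs.1
    have h1 : 0 < 1 - s := by linarith [hs.2]
    have e1 : (a - a / s) * (a - a / s - a) = (a * a * (1 - s)) * (s * s)⁻¹ := by
      field_simp
      ring
    have e2 : 2 * b - 1 = b + b - 1 := by ring
    have e3 : -(2 * b) = -b + -b := by ring
    have e4 : 1 - b - 1 = -b := by ring
    rw [e1, e2, e3, e4, sub_sub_cancel, abs_of_pos (by positivity), abs_of_pos (by positivity),
      mul_rpow (by positivity) (by positivity), mul_rpow (by positivity) (by positivity),
      mul_rpow ha.le ha.le, inv_rpow (by positivity), mul_rpow h0.le h0.le, rpow_sub h0,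
      rpow_add h0, rpow_add ha, rpow_one, rpow_neg h0.le, smul_eq_mul]
    have := rpow_pos_of_pos h0 b
    field_simp
  have hi := (integrableOn_rpow_mul_one_sub_rpow (x := 2 * b) (y := 1 - b)
    (by linarith [hb.1]) (by linarith [hb.2])).const_mul (a ^ (-(2 * b)))
  rw [← himg]
  constructor
  · rw [integrableOn_image_iff_integrableOn_abs_deriv_smul measurableSet_Ioo hd hinj]
    exact IntegrableOn.congr_fun hi heq measurableSet_Ioo
  · rw [integral_image_eq_integral_abs_deriv_smul measurableSet_Ioo hd hinj,
      ← setIntegral_congr_fun measurableSet_Ioo heq, integral_const_mul,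
      integral_rpow_mul_one_sub_rpow]

/-- The limiting kernel `(y (y - a))^(-b) |a - y|⁻¹` on `(1, ∞)`, after the substitution
`y = 1 / s`. -/
theorem limit_kernel_Ioi {a b : ℝ} (ha : a ∈ Ioo (0 : ℝ) 1) (hb : 0 < b) :
    IntegrableOn (fun y : ℝ => (y * (y - a)) ^ (-b) * |a - y|⁻¹) (Ioi 1) ∧
    ∫ y in Ioi (1 : ℝ), (y * (y - a)) ^ (-b) * |a - y|⁻¹ =
      (2 * b)⁻¹ * hyp (b + 1) (2 * b) (2 * b + 1) a := by
  have hpos : ∀ s ∈ Icc (0 : ℝ) 1, 0 < 1 - a * s := fun s hs => by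
    nlinarith [ha.1, ha.2, hs.1, hs.2]
  have himg : (fun s : ℝ => s⁻¹) '' Ioo 0 1 = Ioi 1 := by
    simp [inv_Ioo_0_left]
  have hd : ∀ s ∈ Ioo (0 : ℝ) 1,
      HasDerivWithinAt (fun s : ℝ => s⁻¹) (-(s ^ 2)⁻¹) (Ioo 0 1) s := fun s hs =>
    (hasDerivAt_inv hs.1.ne').hasDerivWithinAt
  have hinj : InjOn (fun s : ℝ => s⁻¹) (Ioo 0 1) := inv_injective.injOn
  have heq : ∀ s ∈ Ioo (0 : ℝ) 1, s ^ (2 * b - 1) * (1 - a * s) ^ (-(b + 1)) =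
      |-(s ^ 2)⁻¹| • ((s⁻¹ * (s⁻¹ - a)) ^ (-b) * |a - s⁻¹|⁻¹) := fun s hs => by
    have h0 := hs.1
    have h1 := hpos s (Ioo_subset_Icc_self hs)
    have e1 : s⁻¹ * (s⁻¹ - a) = (1 - a * s) * (s * s)⁻¹ := by
      field_simp
    have e2 : 2 * b - 1 = b + b - 1 := by ring
    have e3 : a - s⁻¹ = -((1 - a * s) * s⁻¹) := by
      field_simp
      ring
    rw [e1, e2, e3, abs_neg, abs_neg, abs_of_pos (by positivity), abs_of_pos (by positivity),
      mul_rpow (by positivity) (by positivity), inv_rpow (by positivity), mul_rpow h0.le h0.le,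
      rpow_sub h0, rpow_add h0, rpow_one, rpow_neg h0.le, neg_add, rpow_add h1, rpow_neg_one,
      smul_eq_mul]
    have := rpow_pos_of_pos h0 b
    field_simp
  have hi : IntegrableOn (fun s : ℝ => s ^ (2 * b - 1) * (1 - a * s) ^ (-(b + 1))) (Ioo 0 1) := by
    refine (IntegrableOn.mul_continuousOn_of_subset (integrableOn_rpow_sub_one (q := 2 * b)
      (by linarith)) ?_ measurableSet_Ioo isCompact_Icc Ioo_subset_Icc_self)
    exact ContinuousOn.rpow_const (by fun_prop) fun s hs => Or.inl (hpos s hs).ne'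
  rw [← himg]
  constructor
  · rw [integrableOn_image_iff_integrableOn_abs_deriv_smul measurableSet_Ioo hd hinj]
    exact hi.congr_fun heq measurableSet_Ioo
  · rw [integral_image_eq_integral_abs_deriv_smul measurableSet_Ioo hd hinj,
      ← setIntegral_congr_fun measurableSet_Ioo heq,
      integral_rpow_mul_one_sub_mul_rpow (by linarith) (by linarith) ha]

/-- Dominated convergence for the rescaled Poisson kernel on a set where `|a - t - y|` is
comparable to `|a - y|`, uniformly in small `t`. -/
theorem tendsto_setIntegral_P0 {α a : ℝ} (ha : 0 < a) {S : Set ℝ} (hS : MeasurableSet S)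
    (hpos : ∀ y ∈ S, 0 < y * (y - a))
    (hdist : ∀ y ∈ S, ∀ t ∈ Ioo 0 (a / 2), |a - y| ≤ 2 * |a - t - y|)
    (hint : IntegrableOn (fun y : ℝ => (y * (y - a)) ^ (-(α / 2)) * |a - y|⁻¹) S) :
    Tendsto (fun t : ℝ => t ^ (-(α / 2)) * ∫ y in S, P0 α a (a - t) y) (𝓝[>] 0)
      (𝓝 (Cc α * a ^ (α / 2) * ∫ y in S, (y * (y - a)) ^ (-(α / 2)) * |a - y|⁻¹)) := by
  have hsmall : ∀ᶠ t : ℝ in 𝓝[>] 0, t ∈ Ioo 0 (a / 2) := Ioo_mem_nhdsGT (by linarith)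
  have hne : ∀ y ∈ S, a - y ≠ 0 := fun y hy h => by
    have := hpos y hy
    rw [← neg_sub, h] at this
    simp at this
  have hconst : Tendsto (fun t : ℝ => Cc α * (a - t) ^ (α / 2)) (𝓝[>] 0)
      (𝓝 (Cc α * a ^ (α / 2))) := by
    have : ContinuousAt (fun t : ℝ => Cc α * (a - t) ^ (α / 2)) 0 :=
      continuousAt_const.mul (ContinuousAt.rpow_const (by fun_prop) (Or.inl (by simp [ha.ne'])))
    simpa using this.tendsto.mono_left nhdsWithin_le_nhds
  have hlim : Tendsto (fun t : ℝ => ∫ y in S, (y * (y - a)) ^ (-(α / 2)) * |a - t - y|⁻¹)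
      (𝓝[>] 0) (𝓝 (∫ y in S, (y * (y - a)) ^ (-(α / 2)) * |a - y|⁻¹)) := by
    refine tendsto_integral_filter_of_dominated_convergence
      (fun y => 2 * ((y * (y - a)) ^ (-(α / 2)) * |a - y|⁻¹)) ?_ ?_ (hint.const_mul 2) ?_
    · exact Eventually.of_forall fun t => Measurable.aestronglyMeasurable (by fun_prop)
    · filter_upwards [hsmall] with t ht
      filter_upwards [ae_restrict_mem hS] with y hy
      have h1 := hdist y hy t ht
      have h2 : 0 < |a - y| := abs_pos.2 (hne y hy)
      have h3 : 0 ≤ (y * (y - a)) ^ (-(α / 2)) := rpow_nonneg (hpos y hy).le _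
      have h4 : |a - t - y|⁻¹ ≤ 2 * |a - y|⁻¹ := by
        rw [← div_eq_mul_inv, inv_eq_one_div, div_le_div_iff₀ (by linarith) h2]
        linarith
      rw [norm_of_nonneg (by positivity)]
      nlinarith [mul_le_mul_of_nonneg_left h4 h3]
    · filter_upwards [ae_restrict_mem hS] with y hy
      have : ContinuousAt (fun t : ℝ => (y * (y - a)) ^ (-(α / 2)) * |a - t - y|⁻¹) 0 :=
        continuousAt_const.mul (ContinuousAt.inv₀ (by fun_prop) (by simpa using hne y hy))
      simpa using this.tendsto.mono_left nhdsWithin_le_nhds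
  refine (hconst.mul hlim).congr' ?_
  filter_upwards [hsmall] with t ht
  rw [← integral_const_mul, ← integral_const_mul]
  refine setIntegral_congr_fun hS fun y hy => ?_
  have h1 : 0 < a - t := by linarith [ht.1, ht.2]
  have h2 := hpos y hy
  have h3 := rpow_pos_of_pos ht.1 (α / 2)
  simp only [P0, sub_sub_cancel]
  rw [div_rpow (mul_pos ht.1 h1).le h2.le, mul_rpow ht.1.le h1.le, rpow_neg h2.le,
    rpow_neg ht.1.le]
  field_simp

/-- `lim_{t→0⁺} t^(-α/2) (∫_{-∞}^0 P_{(0,a)}(a-t,y) dy + ∫_1^∞ P_{(0,a)}(a-t,y) dy)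
  = C_α (T_α a^(-α/2) + α⁻¹ a^(α/2) F_α(a))`. -/
theorem tendsto_normal_derivative (α a : ℝ) (hα : α ∈ Set.Ioo (0:ℝ) 2)
    (ha : a ∈ Set.Ioo (0:ℝ) 1) :
    Tendsto (fun t : ℝ => t ^ (-(α / 2)) *
        ((∫ y in Set.Iio (0:ℝ), P0 α a (a - t) y) + ∫ y in Set.Ioi (1:ℝ), P0 α a (a - t) y))
      (nhdsWithin 0 (Set.Ioi 0))
      (nhds (Cc α * (Tc α * a ^ (-(α / 2)) + α⁻¹ * a ^ (α / 2) * hyp (α / 2 + 1) α (α + 1) a))) := by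
  have hb : α / 2 ∈ Ioo (0 : ℝ) 1 := ⟨by linarith [hα.1], by linarith [hα.2]⟩
  have h2 : 2 * (α / 2) = α := by ring
  obtain ⟨hi₁, he₁⟩ := limit_kernel_Iio ha.1 hb
  obtain ⟨hi₂, he₂⟩ := limit_kernel_Ioi ha hb.1
  have l₁ := tendsto_setIntegral_P0 ha.1 measurableSet_Iio
    (fun y hy => mul_pos_of_neg_of_neg hy (by linarith [mem_Iio.1 hy, ha.1]))
    (fun y hy t ht => by
      have := mem_Iio.1 hy
      rw [abs_of_pos (by linarith [ha.1]), abs_of_pos (by linarith [ht.2, ha.1])]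
      linarith [ht.2]) hi₁
  have l₂ := tendsto_setIntegral_P0 ha.1 measurableSet_Ioi
    (fun y hy => mul_pos (by linarith [mem_Ioi.1 hy]) (by linarith [mem_Ioi.1 hy, ha.2]))
    (fun y hy t ht => by
      have := mem_Ioi.1 hy
      rw [abs_of_neg (by linarith [ha.2]), abs_of_neg (by linarith [ht.1, ha.2])]
      linarith [ht.1, ha.2]) hi₂
  rw [he₁, h2] at l₁
  rw [he₂, h2] at l₂
  have hexp : a ^ (α / 2) * a ^ (-α) = a ^ (-(α / 2)) := by
    rw [← rpow_add ha.1]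
    congr 1
    ring
  convert l₁.add l₂ using 2
  · ring
  · rw [Tc, ← hexp]
    ring
end

section
/- For every α ∈ (0,2), the function R : (0,1) → ℝ defined by R(a) = C_α ( T_α a^{-α/2} + α^{-1} a^{α/2} F_α(a) ) is strictly convex on (0,1). -/
open MeasureTheory Real Filter Set

/-- `R(a) = C_α (T_α a^(-α/2) + α⁻¹ a^(α/2) F_α(a))` where `F_α(a) = ₂F₁(α/2+1, α; α+1; a)`. -/
noncomputable def Rf (α a : ℝ) : ℝ :=
  Cc α * (Tc α * a ^ (-(α / 2)) + α⁻¹ * a ^ (α / 2) * hyp (α / 2 + 1) α (α + 1) a)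

theorem ConvexOn.tsum {ι E : Type*} [AddCommMonoid E] [Module ℝ E] {S : Set E}
    {f : ι → E → ℝ} (hS : Convex ℝ S) (hf : ∀ i, ConvexOn ℝ S (f i))
    (hsum : ∀ x ∈ S, Summable fun i => f i x) : ConvexOn ℝ S fun x => ∑' i, f i x := by
  refine ⟨hS, fun x hx y hy a b ha hb hab => ?_⟩
  simp only [smul_eq_mul]
  rw [← tsum_mul_left, ← tsum_mul_left,
    ← ((hsum x hx).mul_left a).tsum_add ((hsum y hy).mul_left b)]
  exact Summable.tsum_le_tsum (fun i => (hf i).2 hx hy ha hb hab) (hsum _ (hS hx hy ha hb hab))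
    (((hsum x hx).mul_left a).add ((hsum y hy).mul_left b))

theorem intervalIntegrable_rpow_mul_one_sub_rpow {x y : ℝ} (hx : 0 < x) (hy : 0 < y) :
    IntervalIntegrable (fun t : ℝ => t ^ (x - 1) * (1 - t) ^ (y - 1)) volume 0 1 := by
  have h := Complex.betaIntegral_convergent (u := x) (v := y) (by simpa) (by simpa)
  rw [intervalIntegrable_iff_integrableOn_Ioc_of_le zero_le_one] at h ⊢
  refine (integrableOn_congr_fun (fun t ht => ?_) measurableSet_Ioc).1 h.re
  have h1 : (t : ℂ) ^ ((x : ℂ) - 1) = ((t ^ (x - 1) : ℝ) : ℂ) := by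
    rw [Complex.ofReal_cpow ht.1.le]; push_cast; rfl
  have h2 : (1 - (t : ℂ)) ^ ((y : ℂ) - 1) = (((1 - t) ^ (y - 1) : ℝ) : ℂ) := by
    rw [Complex.ofReal_cpow (sub_nonneg.2 ht.2)]; push_cast; rfl
  simp only [h1, h2, ← Complex.ofReal_mul]
  simp

theorem inv_le_betaFn {x y : ℝ} (hx : 0 < x) (hy : 0 < y) (hy1 : y ≤ 1) :
    x⁻¹ ≤ betaFn x y := by
  have h : ∫ t in (0 : ℝ)..1, t ^ (x - 1) = x⁻¹ := by
    rw [integral_rpow (Or.inl (by linarith))]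
    simp [hx.ne']
  rw [← h, betaFn]
  refine intervalIntegral.integral_mono_on_of_le_Ioo zero_le_one
    (intervalIntegral.intervalIntegrable_rpow' (by linarith))
    (intervalIntegrable_rpow_mul_one_sub_rpow hx hy) fun t ht => ?_
  exact le_mul_of_one_le_right (rpow_nonneg ht.1.le _)
    (one_le_rpow_of_pos_of_le_one_of_nonpos (sub_pos.2 ht.2) (by linarith [ht.1]) (by linarith))

theorem strictConvexOn_rpow_neg_add_rpow {s A B : ℝ} (hs : 0 < s) (hB : 0 < B) (hAB : B ≤ A) :
    StrictConvexOn ℝ (Ioo 0 1) fun x : ℝ => A * x ^ (-s) + B * x ^ s := by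
  have hd (p : ℝ) {x : ℝ} (hx : 0 < x) : HasDerivAt (fun x : ℝ => x ^ p) (p * x ^ (p - 1)) x :=
    hasDerivAt_rpow_const (Or.inl hx.ne')
  have h1 {x : ℝ} (hx : 0 < x) : HasDerivAt (fun x : ℝ => A * x ^ (-s) + B * x ^ s)
      (A * (-s * x ^ (-s - 1)) + B * (s * x ^ (s - 1))) x :=
    ((hd _ hx).const_mul A).add ((hd _ hx).const_mul B)
  refine strictConvexOn_of_deriv2_pos' (convex_Ioo 0 1)
    (fun x hx => (h1 hx.1).continuousAt.continuousWithinAt) fun x hx => ?_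
  have h2 : deriv (fun x : ℝ => A * x ^ (-s) + B * x ^ s) =ᶠ[nhds x]
      fun x => A * (-s * x ^ (-s - 1)) + B * (s * x ^ (s - 1)) := by
    filter_upwards [lt_mem_nhds hx.1] with y hy using (h1 hy).deriv
  have h3 : HasDerivAt (fun x : ℝ => A * (-s * x ^ (-s - 1)) + B * (s * x ^ (s - 1)))
      (A * (-s * ((-s - 1) * x ^ (-s - 1 - 1))) + B * (s * ((s - 1) * x ^ (s - 1 - 1)))) x :=
    (((hd _ hx.1).const_mul _).const_mul A).add (((hd _ hx.1).const_mul _).const_mul B)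
  rw [Function.iterate_succ_apply, Function.iterate_one, h2.deriv_eq, h3.deriv]
  have hle : x ^ (s - 1 - 1) ≤ x ^ (-s - 1 - 1) :=
    rpow_le_rpow_of_exponent_ge hx.1 hx.2.le (by linarith)
  have hp : 0 < x ^ (s - 1 - 1) := rpow_pos_of_pos hx.1 _
  have hmul : B * x ^ (s - 1 - 1) ≤ A * x ^ (-s - 1 - 1) :=
    mul_le_mul hAB hle hp.le (hB.le.trans hAB)
  have hBp : 0 < B * x ^ (s - 1 - 1) := mul_pos hB hp
  have hs1 : s * (s + 1) * (B * x ^ (s - 1 - 1)) ≤ s * (s + 1) * (A * x ^ (-s - 1 - 1)) :=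
    mul_le_mul_of_nonneg_left hmul (by positivity)
  have hs2 : 0 < s * s * (B * x ^ (s - 1 - 1)) := by positivity
  linarith

theorem ascPochhammer_eval_mono {x y : ℝ} (hx : 0 < x) (hxy : x ≤ y) (n : ℕ) :
    (ascPochhammer ℝ n).eval x ≤ (ascPochhammer ℝ n).eval y := by
  induction n with
  | zero => simp
  | succ n ih =>
    rw [ascPochhammer_succ_eval, ascPochhammer_succ_eval]
    exact mul_le_mul ih (by linarith) (by positivity) (ascPochhammer_pos n y (hx.trans_le hxy)).le

/-- The `n`-th coefficient of the Gauss hypergeometric series. -/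
noncomputable def hypCoeff (p q r : ℝ) (n : ℕ) : ℝ :=
  ((ascPochhammer ℝ n).eval p * (ascPochhammer ℝ n).eval q) /
    ((ascPochhammer ℝ n).eval r * (n.factorial : ℝ))

theorem hypCoeff_nonneg {p q r : ℝ} (hp : 0 < p) (hq : 0 < q) (hr : 0 < r) (n : ℕ) :
    0 ≤ hypCoeff p q r n := by
  have := ascPochhammer_pos n p hp
  have := ascPochhammer_pos n q hq
  have := ascPochhammer_pos n r hr
  unfold hypCoeff
  positivity

theorem hypCoeff_le {p q r : ℝ} (hp : 0 < p) (hp2 : p ≤ 2) (hq : 0 < q) (hqr : q ≤ r) (n : ℕ) :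
    hypCoeff p q r n ≤ n + 1 := by
  have hr := ascPochhammer_pos n r (hq.trans_le hqr)
  have hfac : (ascPochhammer ℝ n).eval 2 = (n + 1) * n.factorial := by
    have := factorial_mul_ascPochhammer ℝ 1 n
    norm_num [add_comm 1 n, Nat.factorial_succ] at this
    exact this
  rw [hypCoeff, div_le_iff₀ (by positivity)]
  calc _ ≤ (ascPochhammer ℝ n).eval 2 * (ascPochhammer ℝ n).eval r :=
        mul_le_mul (ascPochhammer_eval_mono hp hp2 n) (ascPochhammer_eval_mono hq hqr n)
          (ascPochhammer_pos n q hq).le (ascPochhammer_pos n 2 two_pos).le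
    _ = _ := by rw [hfac]; ring

theorem summable_hypCoeff_mul_pow {p q r : ℝ} (hp : 0 < p) (hp2 : p ≤ 2) (hq : 0 < q)
    (hqr : q ≤ r) {x : ℝ} (hx : x ∈ Ioo (0 : ℝ) 1) :
    Summable fun n => hypCoeff p q r n * x ^ n := by
  have hx1 : ‖x‖ < 1 := by rw [norm_of_nonneg hx.1.le]; exact hx.2
  have h : Summable fun n : ℕ => ((n : ℝ) + 1) * x ^ n := by
    simpa [add_mul] using! (summable_pow_mul_geometric_of_norm_lt_one 1 hx1).add
      (summable_geometric_of_norm_lt_one hx1)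
  exact h.of_nonneg_of_le
    (fun n => mul_nonneg (hypCoeff_nonneg hp hq (hq.trans_le hqr) n) (pow_nonneg hx.1.le n))
    (fun n => mul_le_mul_of_nonneg_right (hypCoeff_le hp hp2 hq hqr n) (pow_nonneg hx.1.le n))

/-- The function `a ↦ R(a)` is strictly convex on `(0,1)`. -/
theorem Rf_strictConvexOn (α : ℝ) (hα : α ∈ Set.Ioo (0:ℝ) 2) :
    StrictConvexOn ℝ (Set.Ioo (0:ℝ) 1) (Rf α) := by
  obtain ⟨h0, h2⟩ := hα
  have hp : 0 < α / 2 + 1 := by linarith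
  have hp2 : α / 2 + 1 ≤ 2 := by linarith
  have hr : α ≤ α + 1 := by linarith
  set c := hypCoeff (α / 2 + 1) α (α + 1) with hc
  have hcsum {x : ℝ} (hx : x ∈ Ioo (0 : ℝ) 1) : Summable fun n => c n * x ^ n :=
    summable_hypCoeff_mul_pow hp hp2 h0 hr hx
  have hterm {x : ℝ} (hx : x ∈ Ioo (0 : ℝ) 1) (n : ℕ) :
      α⁻¹ * x ^ (α / 2) * (c (n + 1) * x ^ (n + 1)) =
        α⁻¹ * c (n + 1) * x ^ (α / 2 + ((n + 1 : ℕ) : ℝ)) := by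
    rw [rpow_add_natCast hx.1.ne']
    ring
  have htail : ConvexOn ℝ (Ioo 0 1) fun x : ℝ =>
      ∑' n : ℕ, α⁻¹ * c (n + 1) * x ^ (α / 2 + ((n + 1 : ℕ) : ℝ)) := by
    refine ConvexOn.tsum (convex_Ioo 0 1) (fun n => ?_) fun x hx => ?_
    · refine ((convexOn_rpow ?_).subset (fun x hx => hx.1.le) (convex_Ioo 0 1)).smul
        (mul_nonneg (inv_nonneg.2 h0.le) (hypCoeff_nonneg hp h0 (by linarith) _))
      push_cast
      linarith [(n.cast_nonneg : (0 : ℝ) ≤ n)]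
    · simp only [← hterm hx]
      exact ((summable_nat_add_iff 1).2 (hcsum hx)).mul_left _
  have hhead := strictConvexOn_rpow_neg_add_rpow (half_pos h0) (inv_pos.2 h0)
    (inv_le_betaFn (y := 1 - α / 2) h0 (by linarith) (by linarith))
  have hC : 0 < Cc α := by
    refine div_pos (sin_pos_of_pos_of_lt_pi (by positivity) ?_) pi_pos
    nlinarith [pi_pos]
  have hsum := hhead.add_convexOn htail
  have hR {x : ℝ} (hx : x ∈ Ioo (0 : ℝ) 1) : Rf α x = Cc α *
      (betaFn α (1 - α / 2) * x ^ (-(α / 2)) + α⁻¹ * x ^ (α / 2) +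
        ∑' n : ℕ, α⁻¹ * c (n + 1) * x ^ (α / 2 + ((n + 1 : ℕ) : ℝ))) := by
    have hhyp : hyp (α / 2 + 1) α (α + 1) x = 1 + ∑' n : ℕ, c (n + 1) * x ^ (n + 1) := by
      change ∑' n, c n * x ^ n = _
      rw [(hcsum hx).tsum_eq_zero_add]
      simp [hc, hypCoeff]
    simp only [← hterm hx]
    rw [Rf, Tc, hhyp, tsum_mul_left]
    ring
  refine ⟨convex_Ioo 0 1, fun x hx y hy hxy a b ha hb hab => ?_⟩
  have h := mul_lt_mul_of_pos_left (hsum.2 hx hy hxy ha hb hab) hC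
  rw [hR hx, hR hy, hR (convex_Ioo 0 1 hx hy ha.le hb.le hab)]
  simp only [Pi.add_apply, smul_eq_mul] at h ⊢
  linarith
end

section
/- For every a ∈ (0,1) and every x ∈ (0,a), (1/π) ∫_a^1 ( (a-x)^{1/2} x^{1/2} ) / ( (z-a)^{1/2} z^{1/2} (z-x) ) dz = (2/π) arctan( x^{1/2} (1-a)^{1/2} / (a-x)^{1/2} ). -/
open Real Set intervalIntegral

/-- A primitive, in `z`, of the Poisson kernel of the half Laplacian on `(0, a)`. -/
theorem hasDerivAt_two_mul_arctan_poisson {a x z : ℝ} (hx : 0 < x) (hxa : x < a) (haz : a < z) :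
    HasDerivAt (fun z => 2 * Real.arctan (Real.sqrt x * Real.sqrt (z - a) /
        (Real.sqrt (a - x) * Real.sqrt z)))
      ((Real.sqrt (a - x) * Real.sqrt x) / (Real.sqrt (z - a) * Real.sqrt z * (z - x))) z := by
  have hz : 0 < z := by linarith
  have h1 : HasDerivAt (fun z => Real.sqrt (z - a)) (1 / (2 * Real.sqrt (z - a))) z :=
    ((hasDerivAt_id z).sub_const a).sqrt (sub_pos.2 haz).ne'
  have h2 : HasDerivAt (fun z => Real.sqrt z) (1 / (2 * Real.sqrt z)) z :=
    Real.hasDerivAt_sqrt hz.ne'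
  have p : 0 < Real.sqrt (a - x) := Real.sqrt_pos.2 (by linarith)
  have q : 0 < Real.sqrt z := Real.sqrt_pos.2 hz
  have r : 0 < Real.sqrt (z - a) := Real.sqrt_pos.2 (by linarith)
  have s : 0 < Real.sqrt x := Real.sqrt_pos.2 hx
  have ep : Real.sqrt (a - x) ^ 2 = a - x := Real.sq_sqrt (by linarith)
  have eq : Real.sqrt z ^ 2 = z := Real.sq_sqrt hz.le
  have er : Real.sqrt (z - a) ^ 2 = z - a := Real.sq_sqrt (by linarith)
  have es : Real.sqrt x ^ 2 = x := Real.sq_sqrt hx.le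
  have h := (((h1.const_mul (Real.sqrt x)).div (h2.const_mul (Real.sqrt (a - x)))
    (mul_pos p q).ne').arctan).const_mul 2
  refine h.congr_deriv ?_
  have ha : 0 < a := by linarith
  have hzx : 0 < z - x := by linarith
  have hpyth : 1 + (Real.sqrt x * Real.sqrt (z - a) / (Real.sqrt (a - x) * Real.sqrt z)) ^ 2
      = a * (z - x) / ((Real.sqrt (a - x)) ^ 2 * Real.sqrt z ^ 2) := by
    rw [div_pow, mul_pow, mul_pow, ep, eq, er, es]
    have : a - x ≠ 0 := by linarith
    field_simp
    ring
  simp only [Pi.div_apply]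
  rw [hpyth]
  generalize Real.sqrt (a - x) = P at *
  generalize Real.sqrt (z - a) = R at *
  generalize Real.sqrt z = Q at *
  generalize Real.sqrt x = S at *
  have hQR : Q ^ 2 - R ^ 2 = a := by linarith
  field_simp
  linear_combination hQR

/-- For every `a ∈ (0,1)` and `x ∈ (0,a)`,
`(1/π) ∫_a^1 ((a-x)^(1/2) x^(1/2)) / ((z-a)^(1/2) z^(1/2) (z-x)) dz
  = (2/π) arctan(x^(1/2) (1-a)^(1/2) / (a-x)^(1/2))`. -/
theorem poisson_integral_arctan (a x : ℝ) (ha : a ∈ Set.Ioo (0:ℝ) 1)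
    (hx : x ∈ Set.Ioo (0:ℝ) a) :
    (1 / Real.pi) * ∫ z in a..(1:ℝ),
        (Real.sqrt (a - x) * Real.sqrt x) / (Real.sqrt (z - a) * Real.sqrt z * (z - x))
      = (2 / Real.pi) * Real.arctan (Real.sqrt x * Real.sqrt (1 - a) / Real.sqrt (a - x)) := by
  obtain ⟨ha0, ha1⟩ := ha
  obtain ⟨hx0, hxa⟩ := hx
  have hcont : ContinuousOn (fun z => 2 * Real.arctan (Real.sqrt x * Real.sqrt (z - a) /
      (Real.sqrt (a - x) * Real.sqrt z))) (Set.Icc a 1) := by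
    refine continuousOn_const.mul (Real.continuous_arctan.comp_continuousOn ?_)
    refine ContinuousOn.div (by fun_prop) (by fun_prop) fun z hz => ?_
    exact (mul_pos (Real.sqrt_pos.2 (sub_pos.2 hxa))
      (Real.sqrt_pos.2 (ha0.trans_le hz.1))).ne'
  have hderiv := fun z (hz : z ∈ Set.Ioo a 1) =>
    hasDerivAt_two_mul_arctan_poisson hx0 hxa hz.1
  have hint := integrableOn_deriv_of_nonneg hcont hderiv fun z hz => by
    have : 0 < z - x := by linarith [hz.1]
    positivity
  rw [integral_eq_sub_of_hasDerivAt_of_le ha1.le hcont hderiv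
    ((intervalIntegrable_iff_integrableOn_Ioc_of_le ha1.le).2 hint)]
  simp only [sub_self, Real.sqrt_zero, mul_zero, zero_div, Real.arctan_zero, sub_zero,
    Real.sqrt_one, mul_one]
  ring
end

section
/- Let α = 1 and a ∈ (0,1). For every y ∈ (a,1), ∫_{-a}^{a} (1/π) ( ((y-a)(1-y)) / ((z-a)(z-1)) )^{1/2} |y-z|^{-1} dz = 1 - (2/π) arctan( ( (1+a)^{1/2} (y-a)^{1/2} ) / ( (2a)^{1/2} (1-y)^{1/2} ) ). (Note that for z ∈ (-a,a) one has (z-a)(z-1) > 0.) -/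
open Real Set intervalIntegral

/-- The function `z ↦ -(2/π) arctan √((a-z)/(1-z) · (1-y)/(y-a))` is an antiderivative of the
Poisson kernel of `(a,1)` for `α = 1`, to the left of `a`. -/
theorem hasDerivAt_poisson_antideriv {a y z : ℝ} (hay : a < y) (hy : y < 1)
    (hz : z < a) :
    HasDerivAt
      (fun z => -(2 / Real.pi) * Real.arctan (√((a - z) / (1 - z) * ((1 - y) / (y - a)))))
      ((1 / Real.pi) * √(((y - a) * (1 - y)) / ((z - a) * (z - 1))) * |y - z|⁻¹) z := by
  have h1 : 0 < a - z := by linarith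
  have h2 : 0 < 1 - z := by linarith
  have h3 : 0 < 1 - y := by linarith
  have h4 : 0 < y - a := by linarith
  have h5 : 0 < y - z := by linarith
  have h6 : 0 < 1 - a := by linarith
  have hq : 0 < (a - z) / (1 - z) * ((1 - y) / (y - a)) := by positivity
  have hd := ((((hasDerivAt_id z).const_sub a).div ((hasDerivAt_id z).const_sub 1) h2.ne').mul_const
    ((1 - y) / (y - a))).sqrt hq.ne' |>.arctan.const_mul (-(2 / Real.pi))
  refine hd.congr_deriv ?_
  simp only [id, Pi.div_apply]
  have hs : √(((y - a) * (1 - y)) / ((z - a) * (z - 1)))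
      = (1 - y) / ((1 - z) * √((a - z) / (1 - z) * ((1 - y) / (y - a)))) := by
    rw [show (z - a) * (z - 1) = (a - z) * (1 - z) by ring,
      Real.sqrt_eq_iff_eq_sq (by positivity) (by positivity), div_pow, mul_pow, Real.sq_sqrt hq.le]
    field_simp
  have hsum : 1 + (a - z) / (1 - z) * ((1 - y) / (y - a))
      = (1 - a) * (y - z) / ((1 - z) * (y - a)) := by
    field_simp
    ring
  rw [Real.sq_sqrt hq.le, hsum, hs, abs_of_pos h5]
  have hsq : 0 < √((a - z) / (1 - z) * ((1 - y) / (y - a))) := Real.sqrt_pos.2 hq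
  generalize √((a - z) / (1 - z) * ((1 - y) / (y - a))) = s at hsq
  have hpi := Real.pi_pos
  field_simp
  ring

/-- For `α = 1`, `a ∈ (0,1)` and `y ∈ (a,1)`,
`∫_{-a}^a (1/π) (((y-a)(1-y))/((z-a)(z-1)))^(1/2) |y-z|⁻¹ dz
  = 1 - (2/π) arctan((1+a)^(1/2) (y-a)^(1/2) / ((2a)^(1/2) (1-y)^(1/2)))`. -/
theorem poisson_integral_first_term (a y : ℝ) (ha : a ∈ Set.Ioo (0:ℝ) 1)
    (hy : y ∈ Set.Ioo a 1) :
    (∫ z in (-a)..a,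
        (1 / Real.pi) * Real.sqrt (((y - a) * (1 - y)) / ((z - a) * (z - 1))) * |y - z|⁻¹)
      = 1 - (2 / Real.pi) * Real.arctan
          (Real.sqrt (1 + a) * Real.sqrt (y - a) / (Real.sqrt (2 * a) * Real.sqrt (1 - y))) := by
  obtain ⟨h0, h1⟩ := ha
  obtain ⟨hay, hy1⟩ := hy
  have h3 : 0 < 1 - y := by linarith
  have h4 : 0 < y - a := by linarith
  have hcont : ContinuousOn
      (fun z => -(2 / Real.pi) * Real.arctan (√((a - z) / (1 - z) * ((1 - y) / (y - a)))))
      (Icc (-a) a) := by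
    refine continuousOn_const.mul (Real.continuous_arctan.comp_continuousOn
      (Real.continuous_sqrt.comp_continuousOn (ContinuousOn.mul ?_ continuousOn_const)))
    refine ContinuousOn.div (by fun_prop) (by fun_prop) fun z hz => ?_
    linarith [hz.2]
  have hderiv := fun z (hz : z ∈ Ioo (-a) a) => hasDerivAt_poisson_antideriv hay hy1 hz.2
  have hle : -a ≤ a := by linarith
  rw [integral_eq_sub_of_hasDerivAt_of_le hle hcont hderiv]
  · have hs : √((a - -a) / (1 - -a) * ((1 - y) / (y - a)))
        = (√(1 + a) * √(y - a) / (√(2 * a) * √(1 - y)))⁻¹ := by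
      rw [← Real.sqrt_mul (by linarith), ← Real.sqrt_mul (by linarith),
        ← Real.sqrt_div (by positivity), ← Real.sqrt_inv]
      congr 1
      rw [sub_neg_eq_add, sub_neg_eq_add]
      field_simp
      ring
    have hpos : 0 < √(1 + a) * √(y - a) / (√(2 * a) * √(1 - y)) := by positivity
    have hpi := Real.pi_pos
    simp only [hs, Real.arctan_inv_of_pos hpos, sub_self, zero_div, zero_mul, Real.sqrt_zero,
      Real.arctan_zero, mul_zero]
    field_simp
    ring
  · rw [← uIcc_of_le hle] at hcont
    refine intervalIntegrable_deriv_of_nonneg hcont ?_ fun z _ => by positivity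
    rwa [min_eq_left hle, max_eq_right hle]
end

section
/- Let α ∈ (0,2) and fix x ∈ (0,1). Then the function a ↦ f_a(x) is continuous on the interval (0,x). -/
open MeasureTheory Real Filter Set

/-- Poisson kernel of the fractional Laplacian for the interval `(a,1)`:
`P_{(a,1)}(x,y) = C_α (((x-a)(1-x))/((y-a)(y-1)))^(α/2) |x-y|⁻¹`. -/
noncomputable def Pker (α a x y : ℝ) : ℝ :=
  Cc α * (((x - a) * (1 - x)) / ((y - a) * (y - 1))) ^ (α / 2) * |x - y|⁻¹

/-- `fseq α a n` is `f_a^{(n+1)}`: `f_a^{(1)}(x) = ∫_{-a}^a P_{(a,1)}(x,y) dy` and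
`f_a^{(n)}(x) = ∫_a^1 P_{(a,1)}(x,-y) f_a^{(n-1)}(y) dy` for `n ≥ 2`. -/
noncomputable def fseq (α a : ℝ) : ℕ → ℝ → ℝ
  | 0 => fun x => ∫ y in (-a)..a, Pker α a x y
  | n + 1 => fun x => ∫ y in a..(1:ℝ), Pker α a x (-y) * fseq α a n y

/-- `f_a(x) = Σ_{n=1}^∞ f_a^{(n)}(x)`. -/
noncomputable def ff (α a x : ℝ) : ℝ := ∑' n : ℕ, fseq α a n x

theorem integrableOn_and_integral_beta_kernel {b : ℝ} (hb : b ∈ Ioo (0 : ℝ) 1) :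
    IntegrableOn (fun t : ℝ => t ^ (-b) * (1 - t) ^ (b - 1)) (Ioo 0 1) ∧
      ∫ t in Ioo (0 : ℝ) 1, t ^ (-b) * (1 - t) ^ (b - 1) = π / sin (π * b) := by
  have h1 : 0 < 1 - b := sub_pos.2 hb.2
  have hconv : IntegrableOn (fun t : ℝ => (t : ℂ) ^ (((1 - b : ℝ) : ℂ) - 1) *
      (1 - (t : ℂ)) ^ ((b : ℂ) - 1)) (Ioo 0 1) :=
    ((intervalIntegrable_iff_integrableOn_Ioo_of_le zero_le_one).1
      (Complex.betaIntegral_convergent (u := ((1 - b : ℝ) : ℂ)) (v := (b : ℂ))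
        (by simpa using hb.2) (by simpa using hb.1)))
  have hre : EqOn (fun t : ℝ => ((t : ℂ) ^ (((1 - b : ℝ) : ℂ) - 1) *
      (1 - (t : ℂ)) ^ ((b : ℂ) - 1)).re) (fun t : ℝ => t ^ (-b) * (1 - t) ^ (b - 1))
      (Ioo 0 1) := by
    intro t ht
    have e : (t : ℂ) ^ (((1 - b : ℝ) : ℂ) - 1) * (1 - (t : ℂ)) ^ ((b : ℂ) - 1) =
        ((t ^ (-b) * (1 - t) ^ (b - 1) : ℝ) : ℂ) := by
      rw [Complex.ofReal_mul, Complex.ofReal_cpow ht.1.le,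
        Complex.ofReal_cpow (sub_nonneg.2 ht.2.le)]
      push_cast
      congr 2
      ring
    simp only [e, Complex.ofReal_re]
  refine ⟨IntegrableOn.congr_fun hconv.re hre measurableSet_Ioo, ?_⟩
  have hval := ProbabilityTheory.beta_eq_betaIntegralReal (1 - b) b h1 hb.1
  rw [ProbabilityTheory.beta, mul_comm, Gamma_mul_Gamma_one_sub, sub_add_cancel, Gamma_one,
    div_one] at hval
  rw [hval, ← setIntegral_congr_fun measurableSet_Ioo hre, Complex.betaIntegral,
    intervalIntegral.integral_of_le zero_le_one, integral_Ioc_eq_integral_Ioo]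
  exact integral_re hconv

/-- The Poisson kernel of a half-line, at distance `d` from the boundary, up to its constant. -/
noncomputable def halfLineKernel (b d s : ℝ) : ℝ := (d / s) ^ b / (s + d)

theorem halfLineKernel_nonneg {b d s : ℝ} (hd : 0 < d) (hs : 0 ≤ s) :
    0 ≤ halfLineKernel b d s := by
  unfold halfLineKernel; positivity

theorem integrableOn_and_integral_halfLineKernel {b d : ℝ} (hb : b ∈ Ioo (0 : ℝ) 1)
    (hd : 0 < d) :
    IntegrableOn (halfLineKernel b d) (Ioi 0) ∧
      ∫ s in Ioi (0 : ℝ), halfLineKernel b d s = π / sin (π * b) := by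
  have himg : (fun t : ℝ => d * t / (1 - t)) '' Ioo 0 1 = Ioi 0 := by
    ext s
    constructor
    · rintro ⟨t, ⟨h0, h1⟩, rfl⟩
      exact div_pos (mul_pos hd h0) (sub_pos.2 h1)
    · intro hs
      have hs : 0 < s := hs
      have hsd : 0 < s + d := by positivity
      refine ⟨s / (s + d), ⟨by positivity, (div_lt_one hsd).2 (by linarith)⟩, ?_⟩
      have : 1 - s / (s + d) = d / (s + d) := by field_simp; ring
      simp only [this]
      field_simp
  have hder : ∀ t ∈ Ioo (0 : ℝ) 1,
      HasDerivWithinAt (fun t : ℝ => d * t / (1 - t)) (d / (1 - t) ^ 2) (Ioo 0 1) t := by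
    intro t ht
    have h1 : 1 - t ≠ 0 := (sub_pos.2 ht.2).ne'
    have := (((hasDerivAt_id t).const_mul d).div ((hasDerivAt_id t).const_sub 1) h1)
    refine (this.congr_deriv ?_).hasDerivWithinAt
    simp only [id]
    congr 1
    ring
  have hinj : InjOn (fun t : ℝ => d * t / (1 - t)) (Ioo 0 1) := by
    intro t ht u hu h
    have h1 : 1 - t ≠ 0 := (sub_pos.2 ht.2).ne'
    have h2 : 1 - u ≠ 0 := (sub_pos.2 hu.2).ne'
    simp only at h
    rw [div_eq_div_iff h1 h2] at h
    have : d * (t - u) = 0 := by linarith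
    rcases mul_eq_zero.1 this with h | h
    · exact absurd h hd.ne'
    · linarith
  have hcongr : EqOn (fun t : ℝ => |d / (1 - t) ^ 2| • halfLineKernel b d (d * t / (1 - t)))
      (fun t : ℝ => t ^ (-b) * (1 - t) ^ (b - 1)) (Ioo 0 1) := by
    intro t ht
    have h0 := ht.1
    have h1 : 0 < 1 - t := sub_pos.2 ht.2
    have e1 : d / (d * t / (1 - t)) = (1 - t) / t := by field_simp
    have e2 : d * t / (1 - t) + d = d / (1 - t) := by field_simp; ring
    simp only [halfLineKernel, e1, e2, smul_eq_mul]
    rw [abs_of_pos (by positivity), div_rpow h1.le h0.le, rpow_neg h0.le, rpow_sub_one h1.ne']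
    field_simp
  obtain ⟨hi, hv⟩ := integrableOn_and_integral_beta_kernel hb
  constructor
  · rw [← himg, integrableOn_image_iff_integrableOn_abs_deriv_smul measurableSet_Ioo hder hinj]
    exact hi.congr_fun hcongr.symm measurableSet_Ioo
  · rw [← himg, integral_image_eq_integral_abs_deriv_smul measurableSet_Ioo hder hinj,
      setIntegral_congr_fun measurableSet_Ioo hcongr, hv]

theorem intervalIntegrable_halfLineKernel {b d p r : ℝ} (hb : b ∈ Ioo (0 : ℝ) 1)
    (hd : 0 < d) (hp : 0 ≤ p) (hpr : p ≤ r) :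
    IntervalIntegrable (halfLineKernel b d) volume p r :=
  (intervalIntegrable_iff_integrableOn_Ioc_of_le hpr).2
    ((integrableOn_and_integral_halfLineKernel hb hd).1.mono_set fun _ hs => hp.trans_lt hs.1)

theorem Cc_pos {α : ℝ} (hα : α ∈ Ioo (0 : ℝ) 2) : 0 < Cc α := by
  have := hα.1
  refine div_pos (sin_pos_of_pos_of_lt_pi (by positivity) ?_) pi_pos
  nlinarith [pi_pos, hα.2]

theorem half_mem_Ioo {α : ℝ} (hα : α ∈ Ioo (0 : ℝ) 2) : α / 2 ∈ Ioo (0 : ℝ) 1 :=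
  ⟨by linarith [hα.1], by linarith [hα.2]⟩

theorem Cc_mul_integral_halfLineKernel_le_one {α d p r : ℝ} (hα : α ∈ Ioo (0 : ℝ) 2)
    (hd : 0 < d) (hp : 0 ≤ p) (hpr : p ≤ r) :
    Cc α * ∫ s in p..r, halfLineKernel (α / 2) d s ≤ 1 := by
  obtain ⟨hi, hv⟩ := integrableOn_and_integral_halfLineKernel (half_mem_Ioo hα) hd
  have hle : ∫ s in p..r, halfLineKernel (α / 2) d s ≤ π / sin (π * (α / 2)) := by
    rw [← hv, intervalIntegral.integral_of_le hpr]
    refine setIntegral_mono_set hi ?_ (LE.le.eventuallyLE fun s hs => hp.trans_lt hs.1)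
    filter_upwards [ae_restrict_mem measurableSet_Ioi] with s hs
    exact halfLineKernel_nonneg hd (le_of_lt hs)
  refine (mul_le_mul_of_nonneg_left hle (Cc_pos hα).le).trans_eq ?_
  have hs := (Cc_pos hα).ne'
  have hpi := pi_pos.ne'
  have e : π * (α / 2) = π * α / 2 := by ring
  have : sin (π * α / 2) ≠ 0 := fun h => hs (by simp [Cc, h])
  rw [Cc, e]
  field_simp

/-- The ratio by which one step of the recursion contracts. -/
noncomputable def contraction (α a : ℝ) : ℝ := ((1 - a) / (1 + a)) ^ (α / 2)

theorem contraction_nonneg {α a : ℝ} (ha : a ∈ Ioo (0 : ℝ) 1) : 0 ≤ contraction α a :=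
  rpow_nonneg (div_nonneg (by linarith [ha.2]) (by linarith [ha.1])) _

theorem contraction_lt_one {α a : ℝ} (hα : α ∈ Ioo (0 : ℝ) 2) (ha : a ∈ Ioo (0 : ℝ) 1) :
    contraction α a < 1 := by
  have h := ha.1
  have h' := ha.2
  refine rpow_lt_one (div_nonneg (by linarith) (by linarith)) ?_ (half_mem_Ioo hα).1
  rw [div_lt_one (by linarith)]
  linarith

theorem contraction_anti {α a a' : ℝ} (hα : α ∈ Ioo (0 : ℝ) 2) (ha : 0 < a) (haa' : a ≤ a')
    (ha' : a' < 1) : contraction α a' ≤ contraction α a := by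
  refine rpow_le_rpow (div_nonneg (by linarith) (by linarith)) ?_ (half_mem_Ioo hα).1.le
  rw [div_le_div_iff₀ (by linarith [ha, haa']) (by linarith [ha])]
  nlinarith

theorem norm_Pker_le {α a x y : ℝ} (hα : α ∈ Ioo (0 : ℝ) 2) (hx : x ∈ Ioc a 1) (hy : y ≤ a) :
    ‖Pker α a x y‖ ≤ Cc α * halfLineKernel (α / 2) (x - a) (a - y) := by
  have hC := Cc_pos hα
  have hb := (half_mem_Ioo hα).1
  have h1 : 0 < x - a := sub_pos.2 hx.1
  have h2 : 0 ≤ 1 - x := sub_nonneg.2 hx.2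
  have h3 : 0 < 1 - y := by linarith [hx.1, hx.2]
  have h4 : 0 ≤ a - y := sub_nonneg.2 hy
  have h5 : 0 < x - y := by linarith
  have e : (x - a) * (1 - x) / ((y - a) * (y - 1)) = (x - a) / (a - y) * ((1 - x) / (1 - y)) := by
    rw [div_mul_div_comm]; congr 1; ring
  have hr : (1 - x) / (1 - y) ≤ 1 := (div_le_one h3).2 (by linarith)
  have hr0 : 0 ≤ (1 - x) / (1 - y) := by positivity
  rw [Pker, halfLineKernel, e, abs_of_pos h5, Real.norm_of_nonneg (by positivity),
    show a - y + (x - a) = x - y by ring, mul_assoc, div_eq_mul_inv _ (x - y)]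
  gcongr
  exact mul_le_of_le_one_right (by positivity) hr

theorem norm_Pker_neg_le {α a x y : ℝ} (hα : α ∈ Ioo (0 : ℝ) 2) (ha : a ∈ Ioo (0 : ℝ) 1)
    (hx : x ∈ Ioc a 1) (hy : a < y) :
    ‖Pker α a x (-y)‖ ≤
      Cc α * contraction α a * halfLineKernel (α / 2) (x - a) (y + a) := by
  have hC := Cc_pos hα
  have hb := (half_mem_Ioo hα).1
  have ha0 := ha.1
  have h1 : 0 < x - a := sub_pos.2 hx.1
  have h2 : 0 ≤ 1 - x := sub_nonneg.2 hx.2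
  have h3 : 0 < 1 + y := by linarith
  have h4 : 0 < y + a := by linarith
  have h5 : 0 < x + y := by linarith [hx.1]
  have h6 : 0 ≤ 1 - a := by linarith [ha.2]
  have e : (x - a) * (1 - x) / ((-y - a) * (-y - 1)) = (1 - x) / (1 + y) * ((x - a) / (y + a)) := by
    rw [div_mul_div_comm]; congr 1 <;> ring
  have hr : (1 - x) / (1 + y) ≤ (1 - a) / (1 + a) := by
    gcongr
    exact hx.1.le
  rw [Pker, halfLineKernel, contraction, e, show x - -y = x + y by ring, abs_of_pos h5,
    Real.norm_of_nonneg (by positivity), show y + a + (x - a) = x + y by ring, mul_assoc,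
    div_eq_mul_inv _ (x + y), mul_assoc, ← mul_assoc (((1 - a) / (1 + a)) ^ (α / 2)),
    ← mul_rpow (by positivity) (by positivity)]
  gcongr

theorem norm_fseq_le {α a : ℝ} (hα : α ∈ Ioo (0 : ℝ) 2) (ha : a ∈ Ioo (0 : ℝ) 1) (n : ℕ) :
    ∀ x ∈ Ioc a 1, ‖fseq α a n x‖ ≤ contraction α a ^ n := by
  have hb := half_mem_Ioo hα
  have ha0 := ha.1
  have hq := contraction_nonneg (α := α) ha
  induction n with
  | zero =>
    intro x hx
    have hd : 0 < x - a := sub_pos.2 hx.1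
    have hi : IntervalIntegrable (fun y => halfLineKernel (α / 2) (x - a) (a - y))
        volume (-a) a := by
      have := (intervalIntegrable_halfLineKernel hb hd le_rfl
        (by linarith : (0 : ℝ) ≤ 2 * a)).comp_sub_left a
      rw [show a - 0 = a by ring, show a - 2 * a = -a by ring] at this
      exact this.symm
    have hle := intervalIntegral.norm_integral_le_of_norm_le (by linarith : -a ≤ a)
      (Eventually.of_forall fun y hy => norm_Pker_le hα hx hy.2) (hi.const_mul (Cc α))
    refine hle.trans ?_
    rw [intervalIntegral.integral_const_mul, intervalIntegral.integral_comp_sub_left, pow_zero]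
    exact Cc_mul_integral_halfLineKernel_le_one hα hd (by linarith) (by linarith)
  | succ n ih =>
    intro x hx
    have hd : 0 < x - a := sub_pos.2 hx.1
    have hi : IntervalIntegrable (fun y => halfLineKernel (α / 2) (x - a) (y + a)) volume a 1 := by
      have := (intervalIntegrable_halfLineKernel hb hd (by linarith : (0 : ℝ) ≤ a + a)
        (by linarith [ha.2] : a + a ≤ 1 + a)).comp_add_right a
      rwa [show a + a - a = a by ring, show 1 + a - a = 1 by ring] at this
    have hle := intervalIntegral.norm_integral_le_of_norm_le ha.2.le
      (f := fun y => Pker α a x (-y) * fseq α a n y)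
      (Eventually.of_forall fun y hy => by
        rw [norm_mul]
        exact mul_le_mul (norm_Pker_neg_le hα ha hx hy.1) (ih y hy) (norm_nonneg _)
          (mul_nonneg (mul_nonneg (Cc_pos hα).le hq)
            (halfLineKernel_nonneg hd (add_pos (ha0.trans hy.1) ha0).le)))
      ((hi.const_mul (Cc α * contraction α a)).mul_const (contraction α a ^ n))
    refine hle.trans ?_
    rw [intervalIntegral.integral_mul_const, intervalIntegral.integral_const_mul,
      intervalIntegral.integral_comp_add_right, pow_succ', mul_right_comm (Cc α), mul_assoc]
    exact mul_le_of_le_one_left (by positivity)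
      (Cc_mul_integral_halfLineKernel_le_one hα hd (by linarith) (by linarith [ha.2]))

theorem measurable_Pker (α a : ℝ) : Measurable fun p : ℝ × ℝ => Pker α a p.1 p.2 := by
  unfold Pker
  fun_prop

theorem measurable_fseq (α a : ℝ) (n : ℕ) : Measurable (fseq α a n) := by
  have key : ∀ (p r : ℝ) (F : ℝ × ℝ → ℝ), Measurable F →
      Measurable fun x => ∫ y in p..r, F (x, y) := by
    intro p r F hF
    simp only [intervalIntegral]
    exact hF.stronglyMeasurable.integral_prod_right'.measurable.sub
      hF.stronglyMeasurable.integral_prod_right'.measurable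
  induction n with
  | zero => exact key _ _ _ (measurable_Pker α a)
  | succ n ih =>
    exact key a 1 (fun p => Pker α a p.1 (-p.2) * fseq α a n p.2)
      (((measurable_Pker α a).comp (measurable_fst.prodMk measurable_snd.neg)).mul
        (ih.comp measurable_snd))

theorem continuousAt_Pker {α x y a : ℝ} (hα : α ∈ Ioo (0 : ℝ) 2) {v : ℝ → ℝ}
    (hv : ContinuousAt v a) (hva : v a = y) (hya : y ≠ a) (hy1 : y ≠ 1) (hxy : x ≠ y) :
    ContinuousAt (fun a => Pker α a x (v a)) a := by
  subst hva
  unfold Pker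
  have hb := (half_mem_Ioo hα).1
  refine (continuousAt_const.mul (ContinuousAt.rpow_const ?_ (Or.inr hb.le))).mul
    (ContinuousAt.inv₀ (by fun_prop) (abs_ne_zero.2 (sub_ne_zero.2 hxy)))
  exact ContinuousAt.div (by fun_prop) (by fun_prop)
    (mul_ne_zero (sub_ne_zero.2 hya) (sub_ne_zero.2 hy1))

theorem continuousAt_fseq_zero {α x a₀ : ℝ} (hα : α ∈ Ioo (0 : ℝ) 2) (hx : x < 1)
    (ha₀ : a₀ ∈ Ioo 0 x) : ContinuousAt (fun a => fseq α a 0 x) a₀ := by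
  obtain ⟨h0, h0x⟩ := ha₀
  have hb := half_mem_Ioo hα
  have hC := Cc_pos hα
  have hscale : (fun a => fseq α a 0 x) = fun a => a * ∫ t in (-1 : ℝ)..1, Pker α a x (a * t) := by
    funext a
    rw [intervalIntegral.mul_integral_comp_mul_left, mul_neg, mul_one, fseq]
  rw [hscale]
  refine continuousAt_id.mul ?_
  set c : ℝ := a₀ / 2 * (1 - x) with hc
  have hcpos : 0 < c := mul_pos (by linarith) (by linarith)
  set e : ℝ := (x - a₀) / 2 with he
  have hepos : 0 < e := by rw [he]; linarith
  refine intervalIntegral.continuousAt_of_dominated_interval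
    (bound := fun t => Cc α * (c ^ (-(α / 2)) * (1 - t) ^ (-(α / 2))) * e⁻¹) ?_ ?_ ?_ ?_
  · exact Eventually.of_forall fun a => ((measurable_Pker α a).comp
      (measurable_const.prodMk (measurable_id.const_mul a))).aestronglyMeasurable
  · filter_upwards [Ioo_mem_nhds (by linarith : a₀ / 2 < a₀) (by linarith : a₀ < (a₀ + x) / 2)]
      with a ha
    obtain ⟨ha1, ha2⟩ := ha
    refine Eventually.of_forall fun t ht => ?_
    rw [uIoc_of_le (by norm_num)] at ht
    obtain ⟨ht1, ht2⟩ := ht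
    have hapos : 0 < a := by linarith
    have hax : a < x := by linarith
    have hat : a * t ≤ a := mul_le_of_le_one_right hapos.le ht2
    have hd : e ≤ x - a * t := by rw [he]; linarith
    have h1t : 0 ≤ 1 - t := by linarith
    rw [Pker, abs_of_pos (hepos.trans_le hd)]
    have e1 : (x - a) * (1 - x) / ((a * t - a) * (a * t - 1)) =
        (x - a) * (1 - x) / (a * (1 - a * t)) * (1 - t)⁻¹ := by
      rw [← div_eq_mul_inv, div_div]; congr 1; ring
    have h1 : 0 < 1 - a * t := by linarith
    have h2 : 0 < x - a := by linarith
    have h3 : 0 < 1 - x := by linarith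
    rw [e1, Real.norm_of_nonneg (mul_nonneg (by positivity)
      (inv_nonneg.2 (hepos.le.trans hd))), rpow_neg hcpos.le, rpow_neg h1t,
      ← inv_rpow hcpos.le, ← inv_rpow h1t, ← mul_rpow (by positivity) (by positivity)]
    have hinv : (x - a * t)⁻¹ ≤ e⁻¹ := inv_anti₀ hepos hd
    have hinv0 : 0 ≤ (x - a * t)⁻¹ := inv_nonneg.2 (hepos.le.trans hd)
    gcongr
    · exact hb.1.le
    · rw [← one_div]
      gcongr
      · nlinarith
      · rw [hc]
        gcongr
        linarith
  · have hi : IntervalIntegrable (fun t : ℝ => (1 - t) ^ (-(α / 2))) volume (-1) 1 := by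
      have := (intervalIntegral.intervalIntegrable_rpow' (a := 0) (b := 2)
        (by linarith [hb.2] : -1 < -(α / 2))).comp_sub_left 1
      norm_num at this
      exact this.symm
    exact ((hi.const_mul _).const_mul _).mul_const _
  · have hne : ∀ᵐ t : ℝ, t ≠ 1 := by simp [ae_iff, measure_singleton]
    filter_upwards [hne] with t ht1 ht
    rw [uIoc_of_le (by norm_num)] at ht
    have ht' : t < 1 := lt_of_le_of_ne ht.2 ht1
    have : a₀ * t < a₀ := mul_lt_of_lt_one_right h0 ht'
    exact continuousAt_Pker hα (v := fun a => a * t) (by fun_prop) rfl this.ne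
      (by linarith : a₀ * t < 1).ne (by linarith : a₀ * t < x).ne'

theorem continuousAt_fseq {α : ℝ} (hα : α ∈ Ioo (0 : ℝ) 2) (n : ℕ) :
    ∀ x < 1, ∀ a₀ ∈ Ioo 0 x, ContinuousAt (fun a => fseq α a n x) a₀ := by
  have hb := half_mem_Ioo hα
  have hC := Cc_pos hα
  induction n with
  | zero => exact fun x hx a₀ ha₀ => continuousAt_fseq_zero hα hx ha₀
  | succ n ih =>
    rintro x hx a₀ ⟨h0, h0x⟩
    have hev : ∀ᶠ a in nhds a₀, a ∈ Ioo (a₀ / 2) x :=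
      Ioo_mem_nhds (by linarith) h0x
    have hind : (fun a => fseq α a (n + 1) x) =ᶠ[nhds a₀] fun a =>
        ∫ y in Ioc 0 1, (Ioc a 1).indicator (fun y => Pker α a x (-y) * fseq α a n y) y := by
      filter_upwards [hev] with a ha
      have ha0 : 0 < a := by linarith [ha.1]
      rw [setIntegral_indicator measurableSet_Ioc, inter_eq_self_of_subset_right
        (Ioc_subset_Ioc_left ha0.le), ← intervalIntegral.integral_of_le (ha.2.trans hx).le, fseq]
    refine ContinuousAt.congr ?_ hind.symm
    refine continuousAt_of_dominated
      (bound := fun _ => Cc α * (1 / (a₀ / 2)) ^ (α / 2) * x⁻¹) ?_ ?_ ?_ ?_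
    · refine Eventually.of_forall fun a => (Measurable.indicator ?_
        measurableSet_Ioc).aestronglyMeasurable
      exact ((measurable_Pker α a).comp (measurable_const.prodMk measurable_neg)).mul
        (measurable_fseq α a n)
    · filter_upwards [hev] with a ha
      obtain ⟨ha1, ha2⟩ := ha
      have ha0 : 0 < a := by linarith
      have hx0 : 0 < x := by linarith
      refine Eventually.of_forall fun y => ?_
      by_cases hy : y ∈ Ioc a 1
      · rw [indicator_of_mem hy, norm_mul]
        have ha' : a ∈ Ioo (0 : ℝ) 1 := ⟨ha0, ha2.trans hx⟩
        have hf : ‖fseq α a n y‖ ≤ 1 := (norm_fseq_le hα ha' n y hy).trans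
          (pow_le_one₀ (contraction_nonneg ha') (contraction_lt_one hα ha').le)
        refine (mul_le_of_le_one_right (norm_nonneg _) hf).trans ?_
        have hy0 : 0 < y := ha0.trans hy.1
        have h2 : 0 < x - a := by linarith
        have h3 : 0 < 1 - x := by linarith
        rw [Pker, show x - -y = x + y by ring, abs_of_pos (by positivity),
          show (-y - a) * (-y - 1) = (y + a) * (y + 1) by ring,
          Real.norm_of_nonneg (by positivity)]
        gcongr
        · exact hb.1.le
        · nlinarith
        · nlinarith
        · linarith
      · rw [indicator_of_notMem hy, norm_zero]
        positivity
    · exact integrable_const _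
    · have hne : ∀ᵐ y : ℝ, y ≠ a₀ ∧ y ≠ 1 := by
        refine Eventually.and ?_ ?_ <;> simp [ae_iff, measure_singleton]
      filter_upwards [ae_restrict_of_ae hne, ae_restrict_mem measurableSet_Ioc] with y hy hy01
      rcases lt_or_gt_of_ne hy.1 with hlt | hgt
      · refine (continuousAt_const (y := (0 : ℝ))).congr ?_
        filter_upwards [lt_mem_nhds hlt] with a ha
        rw [indicator_of_notMem fun h => ha.not_gt h.1]
      · have hy1 : y < 1 := lt_of_le_of_ne hy01.2 hy.2
        have hcont := (continuousAt_Pker (x := x) (a := a₀) hα (v := fun _ => -y)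
          continuousAt_const rfl (by linarith : -y < a₀).ne (by linarith : -y < 1).ne
          (by linarith : -y < x).ne').mul (ih y hy1 a₀ ⟨h0, hgt⟩)
        refine hcont.congr ?_
        filter_upwards [gt_mem_nhds hgt] with a ha
        rw [indicator_of_mem (show y ∈ Ioc a 1 from ⟨ha, hy01.2⟩), Pi.mul_apply]

/-- For `α ∈ (0,2)` and fixed `x ∈ (0,1)`, the function `a ↦ f_a(x)` is continuous on `(0,x)`. -/
theorem ff_continuousOn (α x : ℝ) (hα : α ∈ Set.Ioo (0:ℝ) 2) (hx : x ∈ Set.Ioo (0:ℝ) 1) :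
    ContinuousOn (fun a : ℝ => ff α a x) (Set.Ioo 0 x) := by
  intro a₀ ha₀
  have hc : a₀ / 2 ∈ Ioo (0 : ℝ) 1 := ⟨by linarith [ha₀.1], by linarith [ha₀.1, ha₀.2, hx.2]⟩
  have hsum : ContinuousOn (fun a : ℝ => ff α a x) (Ioo (a₀ / 2) x) := by
    refine continuousOn_tsum
      (fun n a ha => (continuousAt_fseq hα n x hx.2 a ⟨hc.1.trans ha.1, ha.2⟩).continuousWithinAt)
      (summable_geometric_of_lt_one (contraction_nonneg (α := α) hc) (contraction_lt_one hα hc))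
      fun n a ha => ?_
    have ha' : a ∈ Ioo (0 : ℝ) 1 := ⟨hc.1.trans ha.1, ha.2.trans hx.2⟩
    exact (norm_fseq_le hα ha' n x ⟨ha.2, hx.2.le⟩).trans
      (pow_le_pow_left₀ (contraction_nonneg ha') (contraction_anti hα hc.1 ha.1.le ha'.2) n)
  exact (hsum.continuousAt (Ioo_mem_nhds (by linarith [ha₀.1]) ha₀.2)).continuousWithinAt
end
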